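/- Let κ, η, κ', η' ∈ L satisfy B(κ,κ) = B(κ',κ'), B(κ,η) = B(κ',η'), and B(η,η) = B(η',η') (equivalently, B(κ − tη, κ − tη) = B(κ' − tη', κ' − tη') for all t ∈ ℝ), and suppose that each of the pairs κ, η and κ', η' induces a primitive embedding ℤ² ↪ L. Then there exists an isometry of L, i.e. a ℤ-linear automorphism φ of L with B(φ(x), φ(y)) = B(x,y) for all x, y ∈ L, such that φ(κ') = κ and φ(η') = η. -/

import Mathlib

/-- The hyperbolic plane lattice `U`. -/
def UMat : Matrix (Fin 2) (Fin 2) ℤ := !![0, 1; 1, 0]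

/-- The Gram matrix of the `E₈` root lattice: `2`'s on the diagonal and `-1`
at the edges of the `E₈` Dynkin diagram (a chain `0-1-2-3-4-5-6` with the
extra node `7` attached to node `2`). -/
def E8Mat : Matrix (Fin 8) (Fin 8) ℤ :=
  !![ 2, -1,  0,  0,  0,  0,  0,  0;
     -1,  2, -1,  0,  0,  0,  0,  0;
      0, -1,  2, -1,  0,  0,  0, -1;
      0,  0, -1,  2, -1,  0,  0,  0;
      0,  0,  0, -1,  2, -1,  0,  0;
      0,  0,  0,  0, -1,  2, -1,  0;
      0,  0,  0,  0,  0, -1,  2,  0;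
      0,  0, -1,  0,  0,  0,  0,  2]

/-- The block diagonal matrix `diag(U, U, U, -E₈, -E₈)`. -/
def K3GramBlocks :
    Matrix (Fin 2 ⊕ (Fin 2 ⊕ (Fin 2 ⊕ (Fin 8 ⊕ Fin 8))))
      (Fin 2 ⊕ (Fin 2 ⊕ (Fin 2 ⊕ (Fin 8 ⊕ Fin 8)))) ℤ :=
  Matrix.fromBlocks UMat 0 0
    (Matrix.fromBlocks UMat 0 0
      (Matrix.fromBlocks UMat 0 0
        (Matrix.fromBlocks (-E8Mat) 0 0 (-E8Mat))))

/-- Reindexing the blocks by `Fin 22`. -/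
def K3Reindex : (Fin 2 ⊕ (Fin 2 ⊕ (Fin 2 ⊕ (Fin 8 ⊕ Fin 8)))) ≃ Fin 22 :=
  (Equiv.sumCongr (Equiv.refl (Fin 2))
    ((Equiv.sumCongr (Equiv.refl (Fin 2))
      ((Equiv.sumCongr (Equiv.refl (Fin 2)) finSumFinEquiv).trans
        finSumFinEquiv)).trans finSumFinEquiv)).trans finSumFinEquiv

/-- The Gram matrix of the K3 lattice on `ℤ²²`. -/
def K3Gram : Matrix (Fin 22) (Fin 22) ℤ :=
  Matrix.reindex K3Reindex K3Reindex K3GramBlocks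

/-- The K3 lattice bilinear form on `ℤ²² = Fin 22 → ℤ`. -/
def K3Form (x y : Fin 22 → ℤ) : ℤ :=
  dotProduct x (K3Gram.mulVec y)

/-- A pair `κ, η ∈ ℤ²²` induces a primitive embedding `ℤ² ↪ L`: `κ` and `η`
are ℤ-linearly independent, and whenever `x, y : ℝ` are such that `x•κ + y•η`
lies in the image of `L = ℤ²²` in `L ⊗ ℝ = ℝ²²` (i.e. has integer
coordinates), then `x` and `y` are integers. -/
def PrimitivePair (κ η : Fin 22 → ℤ) : Prop :=
  (∀ a b : ℤ, a • κ + b • η = 0 → a = 0 ∧ b = 0) ∧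
    ∀ x y : ℝ, (∀ i : Fin 22, ∃ m : ℤ, x * (κ i : ℝ) + y * (η i : ℝ) = (m : ℝ)) →
      (∃ m : ℤ, (m : ℝ) = x) ∧ ∃ n : ℤ, (n : ℝ) = y

section Eichler
variable {V : Type*} [AddCommGroup V]

/-- Isometries fixing a set pointwise and carrying `v` to `v'`. -/
def EOrb (B : V →ₗ[ℤ] V →ₗ[ℤ] ℤ) (F : Set V) (v v' : V) : Prop :=
  ∃ φ : V ≃ₗ[ℤ] V, (∀ x y, B (φ x) (φ y) = B x y) ∧ (∀ x ∈ F, φ x = x) ∧ φ v = v'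

theorem EOrb.refl (B : V →ₗ[ℤ] V →ₗ[ℤ] ℤ) (F : Set V) (v : V) : EOrb B F v v :=
  ⟨LinearEquiv.refl ℤ V, fun _ _ => rfl, fun _ _ => rfl, rfl⟩

theorem EOrb.trans {B : V →ₗ[ℤ] V →ₗ[ℤ] ℤ} {F : Set V} {u v w : V}
    (h : EOrb B F u v) (h' : EOrb B F v w) : EOrb B F u w := by
  obtain ⟨φ, h1, h2, h3⟩ := h
  obtain ⟨ψ, k1, k2, k3⟩ := h'
  refine ⟨φ.trans ψ, ?_, ?_, ?_⟩
  · intro x y; simp [k1, h1]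
  · intro x hx; simp [h2 x hx, k2 x hx]
  · simp [h3, k3]

/-- Eichler transvection as a function. -/
def eichlerFun (B : V →ₗ[ℤ] V →ₗ[ℤ] ℤ) (q : V → ℤ) (u m : V) : V →ₗ[ℤ] V where
  toFun z := z - B m z • u + B u z • m - (q m * B u z) • u
  map_add' x y := by simp only [map_add]; module
  map_smul' c x := by simp only [map_smul, RingHom.id_apply, smul_eq_mul]; module

theorem eichlerFun_apply (B : V →ₗ[ℤ] V →ₗ[ℤ] ℤ) (q : V → ℤ) (u m z : V) :
    eichlerFun B q u m z = z - B m z • u + B u z • m - (q m * B u z) • u := rfl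

variable {B : V →ₗ[ℤ] V →ₗ[ℤ] ℤ} {q : V → ℤ}

theorem eichlerFun_inv (hs : ∀ x y, B x y = B y x)
    (hq : ∀ x, B x x = 2 * q x) (u m : V) (hu : B u u = 0) (hum : B u m = 0) (z : V) :
    eichlerFun B q u (-m) (eichlerFun B q u m z) = z := by
  have hqn : q (-m) = q m := by
    have h1 := hq (-m); have h2 := hq m
    simp at h1; linarith
  have hmu : B m u = 0 := by rw [hs]; exact hum
  simp only [eichlerFun_apply, map_add, map_sub, map_smul, map_neg, LinearMap.neg_apply, hu, hum,
    hmu, hqn, hq m, smul_eq_mul]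
  module

theorem EOrb.eichler (hs : ∀ x y, B x y = B y x)
    (hq : ∀ x, B x x = 2 * q x) (F : Set V) (u m v : V) (hu : B u u = 0) (hum : B u m = 0)
    (huF : ∀ x ∈ F, B u x = 0) (hmF : ∀ x ∈ F, B m x = 0) :
    EOrb B F v (v - B m v • u + B u v • m - (q m * B u v) • u) := by
  refine ⟨LinearEquiv.ofLinearMap (eichlerFun B q u m) (eichlerFun B q u (-m)) ?_ ?_, ?_, ?_, ?_⟩
  · ext z
    have := eichlerFun_inv hs hq u (-m) hu (by simp [hum]) z
    simpa using this
  · ext z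
    simpa using eichlerFun_inv hs hq u m hu hum z
  · intro x y
    have hmu : B m u = 0 := by rw [hs]; exact hum
    simp only [LinearEquiv.coe_ofLinearMap, eichlerFun_apply, map_add, map_sub, map_smul,
      LinearMap.add_apply, LinearMap.sub_apply, LinearMap.smul_apply, hu, hum, hmu, hq m,
      smul_eq_mul, hs x u, hs x m]
    ring
  · intro x hx
    simp [eichlerFun_apply, huF x hx, hmF x hx]
  · rfl

/-- Two orthogonal hyperbolic planes orthogonal to `F`. -/
structure Hyp2 (B : V →ₗ[ℤ] V →ₗ[ℤ] ℤ) (F : Set V) (e f e' f' : V) : Prop where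
  ee : B e e = 0
  ff : B f f = 0
  ef : B e f = 1
  fe : B f e = 1
  ee' : B e' e' = 0
  ff' : B f' f' = 0
  ef' : B e' f' = 1
  fe' : B f' e' = 1
  x1 : B e e' = 0
  x2 : B e f' = 0
  x3 : B f e' = 0
  x4 : B f f' = 0
  y1 : B e' e = 0
  y2 : B f' e = 0
  y3 : B e' f = 0
  y4 : B f' f = 0
  eF : ∀ x ∈ F, B e x = 0
  fF : ∀ x ∈ F, B f x = 0
  eF' : ∀ x ∈ F, B e' x = 0
  fF' : ∀ x ∈ F, B f' x = 0

theorem Hyp2.swap {F : Set V} {e f e' f' : V} (H : Hyp2 B F e f e' f') :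
    Hyp2 B F e f f' e' :=
  ⟨H.ee, H.ff, H.ef, H.fe, H.ff', H.ee', H.fe', H.ef', H.x2, H.x1, H.x4, H.x3, H.y2, H.y1,
    H.y4, H.y3, H.eF, H.fF, H.fF', H.eF'⟩

theorem q_zero (hq : ∀ x, B x x = 2 * q x) {x : V} (t : ℤ) (h : B x x = 0) : q (t • x) = 0 := by
  have := hq (t • x)
  simp [h] at this
  exact this

/-- the move `a ↦ a - t c`. -/
theorem Hyp2.moveA (hs : ∀ x y, B x y = B y x)
    (hq : ∀ x, B x x = 2 * q x) {F : Set V} {e f e' f' : V} (H : Hyp2 B F e f e' f') (v : V) (t : ℤ) :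
    EOrb B F v (v - (t * B f' v) • e + (t * B e v) • f') := by
  have := EOrb.eichler hs hq F e (t • f') v H.ee (by simp [H.x2]) H.eF
    (fun x hx => by simp [H.fF' x hx])
  convert this using 1
  simp only [map_smul, LinearMap.smul_apply, smul_eq_mul, q_zero hq t H.ff']
  module

/-- the move `c ↦ c - t a`. -/
theorem Hyp2.moveC (hs : ∀ x y, B x y = B y x)
    (hq : ∀ x, B x x = 2 * q x) {F : Set V} {e f e' f' : V} (H : Hyp2 B F e f e' f') (v : V) (t : ℤ) :
    EOrb B F v (v - (t * B f v) • e' + (t * B e' v) • f) := by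
  have := EOrb.eichler hs hq F e' (t • f) v H.ee' (by simp [H.y3]) H.eF'
    (fun x hx => by simp [H.fF x hx])
  convert this using 1
  simp only [map_smul, LinearMap.smul_apply, smul_eq_mul, q_zero hq t H.ff]
  module

theorem exists_small (a c : ℤ) (hc : c ≠ 0) : ∃ t : ℤ, 0 < a - t * c ∧ a - t * c ≤ |c| := by
  refine ⟨(a - 1) / c, ?_⟩
  have h1 := Int.emod_nonneg (a - 1) hc
  have h2 := Int.emod_lt_abs (a - 1) hc
  have h3 := Int.emod_add_mul_ediv (a - 1) c
  constructor <;> nlinarith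

/-- If `c ≠ 0`, move to an element with `0 < a ≤ |c|`. -/
theorem Hyp2.small (hs : ∀ x y, B x y = B y x)
    (hq : ∀ x, B x x = 2 * q x) {F : Set V} {e f e' f' : V} (H : Hyp2 B F e f e' f') (v : V)
    (hc : B f' v ≠ 0) : ∃ v', EOrb B F v v' ∧ 0 < B f v' ∧ B f v' ≤ |B f' v| := by
  obtain ⟨t, h1, h2⟩ := exists_small (B f v) (B f' v) hc
  refine ⟨_, H.moveA hs hq v t, ?_⟩
  have h : B f (v - (t * B f' v) • e + (t * B e v) • f') = B f v - t * B f' v := by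
    simp [H.fe, H.x4]
  rw [h]
  exact ⟨h1, h2⟩

/-- Key reduction. -/
theorem Hyp2.reduce (hs : ∀ x y, B x y = B y x)
    (hq : ∀ x, B x x = 2 * q x) {F : Set V} {e f e' f' : V} (H : Hyp2 B F e f e' f') (v : V) :
    ∃ v', EOrb B F v v' ∧ B e' v' = 0 ∧ B f' v' = 0 ∧
      ∀ m, (∀ x ∈ F, B m x = 0) → B f v' ∣ B m v' := by
  classical
  -- a good element: `a` divides every `c` and every `d` reachable with the same `a`
  have key : ∃ v₀, EOrb B F v v₀ ∧ ∀ v', EOrb B F v v' → B f v' = B f v₀ →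
      B f v₀ ∣ B f' v' ∧ B f v₀ ∣ B e' v' := by
    by_cases hne : ∃ n : ℕ, 0 < n ∧ ∃ v', EOrb B F v v' ∧ (B f v').natAbs = n
    · obtain ⟨N, ⟨hpos, v₀, hv₀, hn⟩, hmin⟩ :
          ∃ N, (0 < N ∧ ∃ v', EOrb B F v v' ∧ (B f v').natAbs = N) ∧
            ∀ k < N, ¬ (0 < k ∧ ∃ v', EOrb B F v v' ∧ (B f v').natAbs = k) :=
        ⟨Nat.find hne, Nat.find_spec hne, fun k hk => Nat.find_min hne hk⟩
      have ha : B f v₀ ≠ 0 := by omega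
      refine ⟨v₀, hv₀, ?_⟩
      have aux : ∀ {e' f' : V}, Hyp2 B F e f e' f' → ∀ v', EOrb B F v v' → B f v' = B f v₀ →
          B f v₀ ∣ B f' v' := by
        intro e' f' H v' hv' hav
        by_contra hnd
        have hm := H.moveC hs hq v' (B f' v' / B f v₀)
        set v₁ := v' - (B f' v' / B f v₀ * B f v') • e' + (B f' v' / B f v₀ * B e' v') • f
        have hc : B f' v₁ = B f' v' % B f v₀ := by
          simp [v₁, H.fe', H.y4, hav, Int.emod_def]; ring
        have hc0 : B f' v₁ ≠ 0 := by
          rw [hc]; intro h; exact hnd (Int.dvd_of_emod_eq_zero h)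
        have hlt : |B f' v₁| < |B f v₀| := by
          rw [hc, abs_of_nonneg (Int.emod_nonneg _ ha)]
          exact Int.emod_lt_abs _ ha
        obtain ⟨v₂, h2, h3, h4⟩ := H.small hs hq v₁ hc0
        rw [Int.abs_eq_natAbs (B f v₀)] at hlt
        exact hmin (B f v₂).natAbs (by omega) ⟨by omega, v₂, (hv'.trans hm).trans h2, rfl⟩
      exact fun v' h h' => ⟨aux H v' h h', aux H.swap v' h h'⟩
    · push Not at hne
      have ha : ∀ v', EOrb B F v v' → B f v' = 0 := by
        intro v' hv'
        by_contra h
        exact hne _ (by omega) v' hv' rfl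
      have aux : ∀ {e' f' : V}, Hyp2 B F e f e' f' → ∀ v', EOrb B F v v' → B f' v' = 0 := by
        intro e' f' H v' hv'
        by_contra h
        obtain ⟨v₂, h2, h3, h4⟩ := H.small hs hq v' h
        have := ha v₂ (hv'.trans h2)
        omega
      refine ⟨v, EOrb.refl _ _ _, fun v' hv' _ => ?_⟩
      rw [aux H v' hv', aux H.swap v' hv']
      simp
  obtain ⟨v₀, hv₀, hk⟩ := key
  obtain ⟨⟨s, hs'⟩, ⟨t, ht⟩⟩ := hk v₀ hv₀ rfl
  have hm1 := H.moveC hs hq v₀ s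
  set v₁ := v₀ - (s * B f v₀) • e' + (s * B e' v₀) • f with hv1
  have a1 : B f v₁ = B f v₀ := by simp [v₁, H.x3, H.ff]
  have c1 : B f' v₁ = 0 := by simp [v₁, H.fe', H.y4, hs']; ring
  have d1 : B e' v₁ = B e' v₀ := by simp [v₁, H.ee', H.y3]
  have hm2 := H.swap.moveC hs hq v₁ t
  set v₂ := v₁ - (t * B f v₁) • f' + (t * B f' v₁) • f with hv2
  have a2 : B f v₂ = B f v₀ := by simp [v₂, H.x4, H.ff, a1]
  have c2 : B f' v₂ = 0 := by simp [v₂, H.ff', H.y4, c1]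
  have d2 : B e' v₂ = 0 := by simp [v₂, H.ef', H.y3, d1, a1, ht]; ring
  have o2 := (hv₀.trans hm1).trans hm2
  refine ⟨v₂, o2, d2, c2, ?_⟩
  intro m hm
  have hw := EOrb.eichler hs hq F e' (m - B e' m • f') v₂ H.ee' (by simp [H.ef']) H.eF'
    (fun x hx => by simp [hm x hx, H.fF' x hx])
  have := (hk _ (o2.trans hw) (by simp [d2, H.x3, a2])).1
  simpa [d2, c2, H.fe', a2] using this

/-- Eichler criterion for primitive vectors. -/
theorem Hyp2.eichler (hs : ∀ x y, B x y = B y x)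
    (hq : ∀ x, B x x = 2 * q x) {F : Set V} {e f e' f' : V} (H : Hyp2 B F e f e' f') (v w : V)
    (hvF : ∀ x ∈ F, B v x = 0) (hwF : ∀ x ∈ F, B w x = 0) (hvw : B w v = 1) :
    ∃ k : ℤ, EOrb B F v (e + k • f) := by
  obtain ⟨v₁, o1, d1, c1, hd⟩ := H.reduce hs hq v
  have ha : B f v₁ ∣ 1 := by
    obtain ⟨φ, p1, p2, p3⟩ := o1
    have := hd (φ w) (fun x hx => by rw [← p2 x hx, p1]; exact hwF x hx)
    rwa [← p3, p1, p3, hvw] at this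
  have h1 : ∃ v₂, EOrb B F v v₂ ∧ B f v₂ = 1 := by
    rcases Int.isUnit_iff.1 (isUnit_of_dvd_one ha) with h | h
    · exact ⟨v₁, o1, h⟩
    · have m1 := H.moveC hs hq v₁ 1
      set v₂ := v₁ - (1 * B f v₁) • e' + (1 * B e' v₁) • f
      have c2 : B f' v₂ = 1 := by simp [v₂, h, d1, c1, H.fe']
      have a2 : B f v₂ = -1 := by simp [v₂, h, d1, H.x3]
      refine ⟨_, (o1.trans m1).trans (H.moveA hs hq v₂ (-2)), ?_⟩
      simp [a2, c2, H.fe, H.x4]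
  obtain ⟨v₂, o2, a2⟩ := h1
  have hv2F : ∀ x ∈ F, B v₂ x = 0 := by
    obtain ⟨φ, p1, p2, p3⟩ := o2
    intro x hx
    rw [← p3, ← p2 x hx, p1]; exact hvF x hx
  have m3 := EOrb.eichler hs hq F f (e + B e v₂ • f - v₂) v₂ H.ff (by simp [H.fe, H.ff, a2]) H.fF
    (fun x hx => by simp [H.eF x hx, H.fF x hx, hv2F x hx])
  refine ⟨B e v₂ - B (e + B e v₂ • f - v₂) v₂ - q (e + B e v₂ • f - v₂), o2.trans ?_⟩
  convert m3 using 1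
  rw [a2]
  module

/-- Normal form for a primitive pair. -/
theorem pair_normal (hs : ∀ x y, B x y = B y x)
    (hq : ∀ x, B x x = 2 * q x) {e₁ f₁ e₂ f₂ e₃ f₃ : V} (H1 : Hyp2 B ∅ e₁ f₁ e₂ f₂)
    (H2 : Hyp2 B {e₁, f₁} e₂ f₂ e₃ f₃) (κ η w₁ w₂ : V) (hw1 : B w₁ κ = 1)
    (hw2 : B w₂ κ = 0) (hw3 : B w₂ η = 1) :
    ∃ φ : V ≃ₗ[ℤ] V, (∀ x y, B (φ x) (φ y) = B x y) ∧
      φ κ = e₁ + q κ • f₁ ∧ φ η = B κ η • f₁ + e₂ + q η • f₂ := by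
  obtain ⟨a, φ₁, p1, -, p3⟩ := H1.eichler hs hq κ w₁ (by simp) (by simp) hw1
  obtain ⟨η₁, ⟨φ₂, r1, r2, r3⟩, d1, c1, -⟩ := H2.reduce hs hq (φ₁ η)
  have re : φ₂ e₁ = e₁ := r2 _ (by simp)
  have rf : φ₂ f₁ = f₁ := r2 _ (by simp)
  have rκ : φ₂ (φ₁ κ) = e₁ + a • f₁ := by rw [p3]; simp [re, rf]
  obtain ⟨w, hwκ, hwη⟩ : ∃ w, B w (e₁ + a • f₁) = 0 ∧ B w η₁ = 1 :=
    ⟨φ₂ (φ₁ w₂), by rw [← rκ, r1, p1, hw2], by rw [← r3, r1, p1, hw3]⟩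
  have E2 := H2.eF; have F2 := H2.fF; have E3 := H2.eF'; have F3 := H2.fF'
  simp only [Set.mem_insert_iff, Set.mem_singleton_iff, forall_eq_or_imp, forall_eq] at E2 F2 E3 F3
  obtain ⟨e21, e21'⟩ := E2
  obtain ⟨f21, f21'⟩ := F2
  obtain ⟨e31, e31'⟩ := E3
  obtain ⟨f31, f31'⟩ := F3
  have g31 : B e₁ e₃ = 0 := by rw [hs]; exact e31
  have g31' : B f₁ e₃ = 0 := by rw [hs]; exact e31'
  have k31 : B e₁ f₃ = 0 := by rw [hs]; exact f31
  have k31' : B f₁ f₃ = 0 := by rw [hs]; exact f31'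
  have i1 := H1.ee; have i2 := H1.ff; have i3 := H1.ef; have i4 := H1.fe
  -- step: add `s e₃`
  obtain ⟨φ₃, s1, s2, s3⟩ := EOrb.eichler hs hq {e₁ + a • f₁} e₃ (e₁ - a • f₁) η₁ H2.ee'
    (by simp [e31, e31']) (by simp [e31, e31']) (by simp [i1, i2, i3, i4])
  rw [d1] at s3
  set s : ℤ := B e₁ η₁ - a * B f₁ η₁ with hsdef
  have s3' : φ₃ η₁ = η₁ - s • e₃ := by rw [s3]; simp [hsdef]
  have sκ : φ₃ (e₁ + a • f₁) = e₁ + a • f₁ := s2 _ rfl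
  set x := B f₁ η₁ with hx
  set y := B e₁ η₁ with hy
  set ζ := η₁ - s • e₃ - x • e₁ - y • f₁ with hζ
  have hwe : B w e₁ = - a * B w f₁ := by simp at hwκ; linarith
  -- the dual vector
  set w0 := w - B w f₁ • e₁ - B w e₁ • f₁ with hw0
  have hw0e : B w0 e₁ = 0 := by simp [w0, i1, i4]
  have hw0f : B w0 f₁ = 0 := by simp [w0, i2, i3]
  have hw0η : B w0 η₁ = 1 - B w f₁ * s := by
    simp [w0, hwη, ← hx, ← hy, hsdef, hwe]; ring
  set w' := w0 - (B w f₁ + B w0 e₃) • f₃ with hw'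
  obtain ⟨k, φ₄, t1, t2, t3⟩ := H2.eichler hs hq ζ w'
    (by
      simp only [Set.mem_insert_iff, Set.mem_singleton_iff, forall_eq_or_imp, forall_eq]
      constructor
      · simp [ζ, i1, i4, e31, hs η₁, ← hy]
      · simp [ζ, i2, i3, e31', hs η₁, ← hx])
    (by
      simp only [Set.mem_insert_iff, Set.mem_singleton_iff, forall_eq_or_imp, forall_eq]
      constructor
      · simp [w', hw0e, f31]
      · simp [w', hw0f, f31'])
    (by
      simp [w', ζ, hw0e, hw0f, hw0η, c1, f31, f31', H2.fe']; ring)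
  have te : φ₄ e₁ = e₁ := t2 _ (by simp)
  have tf : φ₄ f₁ = f₁ := t2 _ (by simp)
  have t4 : φ₄ (η₁ - s • e₃) = x • e₁ + y • f₁ + e₂ + k • f₂ := by
    have : η₁ - s • e₃ = ζ + x • e₁ + y • f₁ := by rw [hζ]; abel
    rw [this, map_add, map_add, map_smul, map_smul, te, tf, t3]; abel
  have tκ : φ₄ (e₁ + a • f₁) = e₁ + a • f₁ := by simp [te, tf]
  obtain ⟨φ₅, v1, v2, v3⟩ := EOrb.eichler hs hq {e₁ + a • f₁} f₂ ((-x) • (e₁ - a • f₁))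
    (x • e₁ + y • f₁ + e₂ + k • f₂) H2.ff
    (by simp [f21, f21']) (by simp [f21, f21']) (by simp [i1, i2, i3, i4])
  have vκ : φ₅ (e₁ + a • f₁) = e₁ + a • f₁ := v2 _ rfl
  obtain ⟨n, hn⟩ : ∃ n : ℤ, φ₅ (x • e₁ + y • f₁ + e₂ + k • f₂) =
      (y + x * a) • f₁ + e₂ + n • f₂ := by
    have hb : B f₂ (x • e₁ + y • f₁ + e₂ + k • f₂) = 1 := by
      simp [f21, f21', H2.fe, H2.ff]
    rw [v3, hb]
    generalize B ((-x) • (e₁ - a • f₁)) _ = A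
    generalize q _ = C
    exact ⟨k - A - C, by module⟩
  let Φ := (((φ₁.trans φ₂).trans φ₃).trans φ₄).trans φ₅
  have hΦ : ∀ x y, B (Φ x) (Φ y) = B x y := by
    intro x y; simp [Φ, v1, t1, s1, r1, p1]
  have hκ : Φ κ = e₁ + a • f₁ := by simp only [Φ, LinearEquiv.trans_apply, rκ, sκ, tκ, vκ]
  have hη : Φ η = (y + x * a) • f₁ + e₂ + n • f₂ := by
    simp only [Φ, LinearEquiv.trans_apply, r3, s3', t4, hn]
  have ha : q κ = a := by
    have h := hq κ
    rw [← hΦ κ κ, hκ] at h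
    simp [i1, i2, i3, i4] at h
    linarith
  have g1 : B e₁ e₂ = 0 := H1.x1
  have g2 : B f₁ e₂ = 0 := H1.x3
  have g3 : B e₁ f₂ = 0 := H1.x2
  have g4 : B f₁ f₂ = 0 := H1.x4
  have hb : B κ η = y + x * a := by
    rw [← hΦ κ η, hκ, hη]
    simp [i1, i2, i3, i4, g1, g2, g3, g4]
  have hc : q η = n := by
    have h := hq η
    rw [← hΦ η η, hη] at h
    simp [i1, i2, i3, i4, g1, g2, g3, g4, e21, e21', f21, f21', H2.ee, H2.ff, H2.ef, H2.fe] at h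
    linarith
  exact ⟨Φ, hΦ, by rw [hκ, ha], by rw [hη, hb, hc]⟩

end Eichler

/-- Inverse of the `E₈` Gram matrix. -/
def E8Inv : Matrix (Fin 8) (Fin 8) ℤ :=
  !![4, 7, 10, 8, 6, 4, 2, 5;
     7, 14, 20, 16, 12, 8, 4, 10;
     10, 20, 30, 24, 18, 12, 6, 15;
     8, 16, 24, 20, 15, 10, 5, 12;
     6, 12, 18, 15, 12, 8, 4, 9;
     4, 8, 12, 10, 8, 6, 3, 6;
     2, 4, 6, 5, 4, 3, 2, 3;
     5, 10, 15, 12, 9, 6, 3, 8]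

theorem E8_mul_inv : E8Mat * E8Inv = 1 := by decide +kernel

theorem U_mul_U : UMat * UMat = 1 := by decide

theorem K3Blocks_inv : ∃ M, K3GramBlocks * M = 1 := by
  refine ⟨Matrix.fromBlocks UMat 0 0
    (Matrix.fromBlocks UMat 0 0
      (Matrix.fromBlocks UMat 0 0
        (Matrix.fromBlocks (-E8Inv) 0 0 (-E8Inv)))), ?_⟩
  simp [K3GramBlocks, Matrix.fromBlocks_multiply, E8_mul_inv, U_mul_U]

theorem K3_surj (α : Fin 22 → ℤ) : ∃ w, K3Gram.mulVec w = α := by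
  obtain ⟨M, hM⟩ := K3Blocks_inv
  refine ⟨(Matrix.reindex K3Reindex K3Reindex M).mulVec α, ?_⟩
  rw [Matrix.mulVec_mulVec, K3Gram]
  simp only [Matrix.reindex_apply, Matrix.submatrix_mul_equiv, hM, Matrix.submatrix_one_equiv,
    Matrix.one_mulVec]

/-- Upper triangular half of the Gram matrix. -/
def K3Half : Matrix (Fin 22) (Fin 22) ℤ :=
  fun i j => if i < j then K3Gram i j else if i = j then K3Gram i j / 2 else 0

theorem K3Gram_half : K3Gram = K3Half + K3Half.transpose := by decide +kernel

/-- Half the square. -/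
def K3q (x : Fin 22 → ℤ) : ℤ := dotProduct x (K3Half.mulVec x)

theorem K3_even (x : Fin 22 → ℤ) : K3Form x x = 2 * K3q x := by
  rw [K3Form, K3Gram_half, Matrix.add_mulVec, dotProduct_add, Matrix.mulVec_transpose,
    dotProduct_comm x (Matrix.vecMul x K3Half), ← Matrix.dotProduct_mulVec, K3q]
  ring

theorem K3_symm (x y : Fin 22 → ℤ) : K3Form x y = K3Form y x := by
  have hT : K3Gram.transpose = K3Gram := by
    rw [K3Gram_half, Matrix.transpose_add, Matrix.transpose_transpose, add_comm]
  rw [K3Form, K3Form, dotProduct_comm, ← hT, Matrix.mulVec_transpose, ← Matrix.dotProduct_mulVec, hT]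

/-- The form as a bilinear map. -/
def K3B : (Fin 22 → ℤ) →ₗ[ℤ] (Fin 22 → ℤ) →ₗ[ℤ] ℤ :=
  LinearMap.mk₂ ℤ K3Form
    (fun x y z => by simp [K3Form, add_dotProduct])
    (fun c x y => by simp only [K3Form, smul_dotProduct])
    (fun x y z => by simp [K3Form, Matrix.mulVec_add, dotProduct_add])
    (fun c x y => by simp only [K3Form, Matrix.mulVec_smul, dotProduct_smul])

theorem K3B_apply (x y : Fin 22 → ℤ) : K3B x y = K3Form x y := rfl

theorem K3B_single (i j : Fin 22) :
    K3B (Pi.single i 1) (Pi.single j 1) = K3Gram i j := by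
  simp [K3B_apply, K3Form]

theorem hypA : Hyp2 K3B ∅ (Pi.single 0 1) (Pi.single 1 1) (Pi.single 2 1) (Pi.single 3 1) := by
  constructor <;> first | (rw [K3B_single]; decide +kernel) | simp

theorem hypB : Hyp2 K3B {Pi.single 0 1, Pi.single 1 1}
    (Pi.single 2 1) (Pi.single 3 1) (Pi.single 4 1) (Pi.single 5 1) := by
  constructor
  all_goals first
    | (rw [K3B_single]; decide +kernel)
    | (simp only [Set.mem_insert_iff, Set.mem_singleton_iff, forall_eq_or_imp, forall_eq,
        K3B_single]; decide +kernel)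

theorem prim_functional (κ η : Fin 22 → ℤ) (h : PrimitivePair κ η) (a b : ℤ) :
    ∃ w, K3B w κ = a ∧ K3B w η = b := by
  obtain ⟨hli, hpr⟩ := h
  let f : (ℤ × ℤ) →ₗ[ℤ] (Fin 22 → ℤ) :=
    (LinearMap.toSpanSingleton ℤ _ κ).coprod (LinearMap.toSpanSingleton ℤ _ η)
  have hf : ∀ p, f p = p.1 • κ + p.2 • η := fun p => by simp [f]
  have hinj : Function.Injective f := by
    rw [injective_iff_map_eq_zero]
    intro p hp
    rw [hf] at hp
    exact Prod.ext (hli _ _ hp).1 (hli _ _ hp).2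
  have htf : Module.IsTorsionFree ℤ ((Fin 22 → ℤ) ⧸ LinearMap.range f) := by
    refine Module.IsTorsionFree.of_smul_eq_zero ?_
    intro r z hz
    by_cases hr : r = 0
    · exact Or.inl hr
    right
    obtain ⟨z, rfl⟩ := Submodule.mkQ_surjective _ z
    rw [← map_smul, Submodule.mkQ_apply, Submodule.Quotient.mk_eq_zero] at hz
    obtain ⟨p, hp⟩ := hz
    rw [hf] at hp
    have hrR : (r : ℝ) ≠ 0 := by exact_mod_cast hr
    obtain ⟨⟨m, hm⟩, ⟨n, hn⟩⟩ := hpr ((p.1 : ℝ) / r) ((p.2 : ℝ) / r) (fun i => by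
      refine ⟨z i, ?_⟩
      have h1 : p.1 * κ i + p.2 * η i = r * z i := by simpa using congrFun hp i
      have h2 : (p.1 : ℝ) * κ i + p.2 * η i = r * z i := by exact_mod_cast h1
      field_simp
      linarith)
    rw [eq_div_iff hrR] at hm hn
    have hm' : m * r = p.1 := by exact_mod_cast hm
    have hn' : n * r = p.2 := by exact_mod_cast hn
    rw [Submodule.mkQ_apply, Submodule.Quotient.mk_eq_zero]
    refine ⟨(m, n), ?_⟩
    rw [hf]
    funext i
    have h1 : p.1 * κ i + p.2 * η i = r * z i := by simpa using congrFun hp i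
    apply mul_left_cancel₀ hr
    rw [← h1, ← hm', ← hn']
    simp
    ring
  have : Module.Free ℤ ((Fin 22 → ℤ) ⧸ LinearMap.range f) := inferInstance
  obtain ⟨σ, hσ⟩ := Module.projective_lifting_property (LinearMap.range f).mkQ LinearMap.id
    (Submodule.mkQ_surjective _)
  have hmem : ∀ z, (LinearMap.id - σ ∘ₗ (LinearMap.range f).mkQ : (Fin 22 → ℤ) →ₗ[ℤ] (Fin 22 → ℤ)) z ∈ LinearMap.range f := by
    intro z
    rw [← Submodule.Quotient.mk_eq_zero, ← Submodule.mkQ_apply]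
    have := LinearMap.congr_fun hσ ((LinearMap.range f).mkQ z)
    simp only [LinearMap.comp_apply, LinearMap.id_apply] at this
    simp only [LinearMap.sub_apply, LinearMap.comp_apply, LinearMap.id_apply, map_sub, this,
      sub_self]
  let g : (Fin 22 → ℤ) →ₗ[ℤ] ℤ × ℤ :=
    (LinearEquiv.ofInjective f hinj).symm.toLinearMap ∘ₗ
      LinearMap.codRestrict (LinearMap.range f) _ hmem
  have hg : ∀ p, g (f p) = p := by
    intro p
    have h0 : (LinearMap.range f).mkQ (f p) = 0 := by
      rw [Submodule.mkQ_apply, Submodule.Quotient.mk_eq_zero]; exact ⟨p, rfl⟩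
    simp only [g, LinearMap.comp_apply, LinearEquiv.coe_coe]
    rw [LinearEquiv.symm_apply_eq]
    apply Subtype.ext
    simp [h0]
  let α : (Fin 22 → ℤ) →ₗ[ℤ] ℤ := (a • LinearMap.fst ℤ ℤ ℤ + b • LinearMap.snd ℤ ℤ ℤ) ∘ₗ g
  obtain ⟨w, hw⟩ := K3_surj (fun i => α (Pi.single i 1))
  have hα : ∀ z, K3B w z = α z := by
    intro z
    rw [K3B_apply, K3_symm, K3Form, hw, LinearMap.pi_apply_eq_sum_univ α z]
    simp only [dotProduct, smul_eq_mul]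
    refine Finset.sum_congr rfl fun i _ => ?_
    congr 2
    funext j
    simp [Pi.single_apply, eq_comm]
  have gκ : g κ = (1, 0) := by rw [← hg (1, 0), hf]; simp
  have gη : g η = (0, 1) := by rw [← hg (0, 1), hf]; simp
  refine ⟨w, ?_, ?_⟩
  · rw [hα]; simp [α, gκ]
  · rw [hα]; simp [α, gη]

/-- If `κ, η` and `κ', η'` are pairs in the K3 lattice with the
same pairwise products, each inducing a primitive embedding `ℤ² ↪ L`, then
there is an isometry of the K3 lattice taking `κ'` to `κ` and `η'` to `η`. -/
theorem stmt_3 (κ η κ' η' : Fin 22 → ℤ)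
    (h1 : K3Form κ κ = K3Form κ' κ')
    (h2 : K3Form κ η = K3Form κ' η')
    (h3 : K3Form η η = K3Form η' η')
    (hprim : PrimitivePair κ η) (hprim' : PrimitivePair κ' η') :
    ∃ φ : (Fin 22 → ℤ) ≃ₗ[ℤ] (Fin 22 → ℤ),
      (∀ x y : Fin 22 → ℤ, K3Form (φ x) (φ y) = K3Form x y) ∧
        φ κ' = κ ∧ φ η' = η := by
  have main : ∀ κ η, PrimitivePair κ η → ∃ φ : (Fin 22 → ℤ) ≃ₗ[ℤ] (Fin 22 → ℤ),
      (∀ x y, K3B (φ x) (φ y) = K3B x y) ∧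
      φ κ = Pi.single 0 1 + K3q κ • Pi.single 1 1 ∧
      φ η = K3B κ η • Pi.single 1 1 + Pi.single 2 1 + K3q η • Pi.single 3 1 := by
    intro κ η h
    obtain ⟨w₁, a1, -⟩ := prim_functional κ η h 1 0
    obtain ⟨w₂, a2, a3⟩ := prim_functional κ η h 0 1
    exact pair_normal K3_symm K3_even hypA hypB κ η w₁ w₂ a1 a2 a3
  obtain ⟨φ, p1, p2, p3⟩ := main κ η hprim
  obtain ⟨ψ, r1, r2, r3⟩ := main κ' η' hprim'
  have q1 : K3q κ = K3q κ' := by have := K3_even κ; have := K3_even κ'; omega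
  have q2 : K3q η = K3q η' := by have := K3_even η; have := K3_even η'; omega
  have q3 : K3B κ η = K3B κ' η' := h2
  refine ⟨ψ.trans φ.symm, ?_, ?_, ?_⟩
  · intro x y
    have := p1 (φ.symm (ψ x)) (φ.symm (ψ y))
    simp only [LinearEquiv.apply_symm_apply] at this
    rw [LinearEquiv.trans_apply, LinearEquiv.trans_apply, ← K3B_apply, ← this, r1]
    rfl
  · rw [LinearEquiv.trans_apply, LinearEquiv.symm_apply_eq, r2, p2, q1]
  · rw [LinearEquiv.trans_apply, LinearEquiv.symm_apply_eq, r3, p3, q2, q3]
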